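/- arXiv:math/0305181 — 2 statements merged into one kernel-verified Lean document; each statement's English description precedes it below -/
import Mathlib

section
/- Let K be a number field and φ ∈ K[z] a polynomial of degree d ≥ 2. For each place v ∈ M_K let F_v ⊆ C_v be the filled Julia set of φ regarded as a polynomial over C_v, and let c(F_v) be its transfinite diameter with respect to |·|_v. Then all but finitely many of the numbers c(F_v)^{n_v} equal 1 and ∏_{v∈M_K} c(F_v)^{n_v} = 1. -/
open Filter

/-- `log⁺ t = log (max t 1)`. -/
noncomputable def logPlus (t : ℝ) : ℝ := Real.log (max t 1)

/-- The `n`-th iterate of the polynomial map `z ↦ φ(z)`. -/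
noncomputable def polyIter {L : Type*} [CommRing L] (φ : Polynomial L) (n : ℕ) : L → L :=
  (fun w => Polynomial.eval w φ)^[n]

/-- A "completed algebraically closed local field" `C_v`: an algebraically closed field,
complete with respect to a nontrivial (multiplicative) absolute value, recorded as the
norm of a normed-field structure. -/
structure PlaceField where
  carrier : Type
  [nf : NormedField carrier]
  [cs : CompleteSpace carrier]
  [ac : IsAlgClosed carrier]
  nontrivial : ∃ x : carrier, 1 < ‖x‖

attribute [instance] PlaceField.nf PlaceField.cs PlaceField.ac

/-- Adelic data for a field `K`: a family of places `v`, for each place a completed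
algebraically closed field `C_v` together with an embedding of a fixed algebraic
closure `K̄` of `K` into `C_v`, and weights `n_v > 0` such that the normalized absolute
values `‖x‖_v = |x|_v^{n_v}` of any nonzero `x ∈ K` are `1` for all but finitely many `v`
and satisfy the product formula `∏_v ‖x‖_v = 1`. -/
structure AdelicData (K : Type) [Field K] where
  V : Type
  C : V → PlaceField
  emb : ∀ v : V, AlgebraicClosure K →+* (C v).carrier
  nv : V → ℝ
  nv_pos : ∀ v, 0 < nv v
  finite_support : ∀ x : K, x ≠ 0 →
    {v : V | ‖emb v (algebraMap K (AlgebraicClosure K) x)‖ ≠ 1}.Finite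
  product_formula : ∀ x : K, x ≠ 0 →
    ∏ᶠ v : V, ‖emb v (algebraMap K (AlgebraicClosure K) x)‖ ^ nv v = 1

/-- The Galois orbit of `α ∈ K̄` over `K`. -/
def galOrbit (K : Type) [Field K] (α : AlgebraicClosure K) : Set (AlgebraicClosure K) :=
  Set.range fun σ : AlgebraicClosure K ≃ₐ[K] AlgebraicClosure K => σ α

/-- A subset of `K̄` is Galois-stable if it is stable under `Gal(K̄/K)`. -/
def GaloisStable (K : Type) [Field K] (S : Set (AlgebraicClosure K)) : Prop :=
  ∀ σ : AlgebraicClosure K ≃ₐ[K] AlgebraicClosure K, σ '' S = S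

namespace AdelicData

variable {K : Type} [Field K] (A : AdelicData K)

/-- The embedding of `K` itself in `C_v`. -/
noncomputable def embK (v : A.V) : K →+* (A.C v).carrier :=
  (A.emb v).comp (algebraMap K (AlgebraicClosure K))

/-- The local summand `∑_v n_v log⁺ |z|_v` of the height of `z ∈ K̄`. -/
noncomputable def locHeight (z : AlgebraicClosure K) : ℝ :=
  ∑ᶠ v : A.V, A.nv v * logPlus ‖A.emb v z‖

/-- The absolute logarithmic Weil height of a finite (Galois-stable) subset `S ⊆ K̄`:
the average over `S` of the sums of normalized local heights. -/
noncomputable def heightSet (S : Set (AlgebraicClosure K)) : ℝ :=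
  (S.ncard : ℝ)⁻¹ * ∑ᶠ z ∈ S, A.locHeight z

/-- The canonical height `ĥ_φ(S) = lim_n d^{-n} h(φ^n(S))` attached to a polynomial
`φ ∈ K[z]` of degree `d` (the limit exists; `Filter.limUnder` extracts it). -/
noncomputable def canonicalHeight (φ : Polynomial K) (S : Set (AlgebraicClosure K)) : ℝ :=
  limUnder atTop fun n : ℕ => ((φ.natDegree : ℝ) ^ n)⁻¹ *
    A.heightSet (polyIter (φ.map (algebraMap K (AlgebraicClosure K))) n '' S)

/-- The height of a single algebraic number: the height of its Galois orbit. -/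
noncomputable def heightAlg (α : AlgebraicClosure K) : ℝ := A.heightSet (galOrbit K α)

/-- The canonical height of a single algebraic number. -/
noncomputable def canonicalHeightAlg (φ : Polynomial K) (α : AlgebraicClosure K) : ℝ :=
  A.canonicalHeight φ (galOrbit K α)

/-- The Northcott finiteness property: for every bound on the degree and on the height
there are only finitely many elements of `K̄` of degree and height at most those bounds. -/
def Northcott : Prop :=
  ∀ (n : ℕ) (B : ℝ),
    {α : AlgebraicClosure K | (minpoly K α).natDegree ≤ n ∧ A.heightAlg α ≤ B}.Finite

end AdelicData

/-- The filled Julia set of the polynomial `φ` over a normed field. -/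
noncomputable def filledJulia {L : Type*} [NormedField L] (φ : Polynomial L) : Set L :=
  {z : L | ¬ Tendsto (fun n : ℕ => ‖polyIter φ n z‖) atTop atTop}

/-- The product of pairwise distances `∏_{i ≠ j} d(x i, x j)`. -/
noncomputable def pairDistProd {α : Type*} (d : α → α → ℝ) {n : ℕ} (x : Fin n → α) : ℝ :=
  ∏ i : Fin n, ∏ j : Fin n, if i = j then 1 else d (x i) (x j)

/-- The `n`-th diameter `d_n(A)` of a set `A` with respect to a distance function `d`. -/
noncomputable def nthDiam {α : Type*} (d : α → α → ℝ) (A : Set α) (n : ℕ) : ℝ :=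
  sSup {r : ℝ | ∃ x : Fin n → α, (∀ i, x i ∈ A) ∧
    r = pairDistProd d x ^ (((n : ℝ) * ((n : ℝ) - 1))⁻¹)}

/-- The transfinite diameter `c(A)`. -/
noncomputable def transDiam {α : Type*} (d : α → α → ℝ) (A : Set α) : ℝ :=
  ⨅ n : ℕ, nthDiam d A (n + 2)

open Polynomial in
/-- The `k`-th compositional iterate of a polynomial. -/
noncomputable def iterPoly {L : Type*} [CommRing L] (φ : L[X]) (k : ℕ) : L[X] := φ.comp^[k] X

namespace iterPoly

open Polynomial

section CommRing

variable {L : Type*} [CommRing L] (φ : L[X])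

theorem eval_eq (k : ℕ) (z : L) : (iterPoly φ k).eval z = polyIter φ k z := by
  simp [iterPoly, polyIter, iterate_comp_eval]

theorem natDegree_eq [IsDomain L] (k : ℕ) : (iterPoly φ k).natDegree = φ.natDegree ^ k := by
  simp [iterPoly, natDegree_iterate_comp]

end CommRing

theorem norm_leadingCoeff_mul_pow {L : Type*} [NormedField L] {φ : L[X]} (hd : φ.natDegree ≠ 0)
    {r : ℝ} (hr : ‖φ.leadingCoeff‖ * r ^ φ.natDegree = r) (k : ℕ) :
    ‖(iterPoly φ k).leadingCoeff‖ * r ^ (φ.natDegree ^ k) = r := by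
  induction k with
  | zero => simp [iterPoly]
  | succ k ih =>
    have h : iterPoly φ (k + 1) = φ.comp (iterPoly φ k) := by
      simp [iterPoly, Function.iterate_succ_apply']
    have h0 : (iterPoly φ k).natDegree ≠ 0 := by
      rw [natDegree_eq]
      exact pow_ne_zero _ hd
    rw [h, leadingCoeff_comp h0, norm_mul, norm_pow, pow_succ, pow_mul, mul_assoc, ← mul_pow, ih, hr]

end iterPoly

section FilledJulia

open Polynomial

variable {L : Type*} [NormedField L] {φ : L[X]}

theorem exists_escape_radius (hd : 2 ≤ φ.natDegree) :
    ∃ R : ℝ, 1 ≤ R ∧ ∀ z : L, R < ‖z‖ → 2 * ‖z‖ ≤ ‖φ.eval z‖ := by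
  have hdeg : 0 < φ.divX.degree := by
    rw [← natDegree_pos_iff_degree_pos, natDegree_divX_eq_natDegree_tsub_one]
    omega
  have h := φ.divX.tendsto_norm_atTop hdeg (l := comap norm atTop) (z := id) tendsto_comap
  obtain ⟨R, hR⟩ := eventually_atTop.1 (eventually_comap.1 (h.eventually_ge_atTop 3))
  refine ⟨max (max R 1) ‖φ.coeff 0‖, le_trans (le_max_right _ _) (le_max_left _ _), fun z hz => ?_⟩
  have hz1 : R ≤ ‖z‖ := (le_trans (le_max_left _ _) (le_max_left _ _)).trans hz.le
  have hz2 : ‖φ.coeff 0‖ ≤ ‖z‖ := (le_max_right _ _).trans hz.le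
  have h3 : 3 ≤ ‖φ.divX.eval z‖ := hR _ hz1 z rfl
  have h4 : φ.eval z = φ.divX.eval z * z + φ.coeff 0 := by
    conv_lhs => rw [← divX_mul_X_add φ]
    simp
  have h5 := norm_sub_le_norm_add (φ.divX.eval z * z) (φ.coeff 0)
  rw [h4]
  rw [norm_mul] at h5
  nlinarith [norm_nonneg z]

theorem polyIter_mem_filledJulia_iff (k : ℕ) (z : L) :
    polyIter φ k z ∈ filledJulia φ ↔ z ∈ filledJulia φ := by
  have h : ∀ n, polyIter φ n (polyIter φ k z) = polyIter φ (n + k) z := fun n => by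
    simp [polyIter, Function.iterate_add_apply]
  simp only [filledJulia, Set.mem_ofPred_eq, h]
  rw [tendsto_add_atTop_iff_nat (f := fun n => ‖polyIter φ n z‖) k]

theorem norm_le_of_mem_filledJulia {R : ℝ} (hR1 : 1 ≤ R)
    (hR : ∀ z : L, R < ‖z‖ → 2 * ‖z‖ ≤ ‖φ.eval z‖) {z : L} (hz : z ∈ filledJulia φ) :
    ‖z‖ ≤ R := by
  by_contra! hlt
  refine hz ?_
  have key : ∀ n, 2 ^ n * ‖z‖ ≤ ‖polyIter φ n z‖ := by
    intro n
    induction n with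
    | zero => simp [polyIter]
    | succ n ih =>
      have h1 : polyIter φ (n + 1) z = φ.eval (polyIter φ n z) := by
        simp [polyIter, Function.iterate_succ_apply']
      have h2 : R < ‖polyIter φ n z‖ := by
        refine hlt.trans_le (le_trans ?_ ih)
        exact le_mul_of_one_le_left (norm_nonneg z) (one_le_pow₀ one_le_two)
      rw [h1, pow_succ]
      linarith [hR _ h2]
  refine tendsto_atTop_mono key ?_
  exact (tendsto_pow_atTop_atTop_of_one_lt one_lt_two).atTop_mul_const (by linarith)

theorem mem_filledJulia_of_bounded {z : L} {B : ℝ} (h : ∀ n, ‖polyIter φ n z‖ ≤ B) :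
    z ∈ filledJulia φ := by
  intro ht
  obtain ⟨n, hn⟩ := (ht.eventually_gt_atTop B).exists
  exact absurd (h n) (not_le.2 hn)

theorem norm_eval_sub_of_unique_preimage [IsAlgClosed L] (hd : φ.natDegree ≠ 0) {x w : L}
    (h : ∀ y, φ.eval y = w → y = x) (z : L) :
    ‖φ.eval z - w‖ = ‖φ.leadingCoeff‖ * ‖z - x‖ ^ φ.natDegree := by
  have hs := IsAlgClosed.splits (φ - C w)
  have hne : φ - C w ≠ 0 := fun h0 => hd (by rw [← natDegree_sub_C (a := w), h0, natDegree_zero])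
  have hroots : (φ - C w).roots = Multiset.replicate φ.natDegree x := by
    rw [Multiset.eq_replicate, ← hs.natDegree_eq_card_roots, natDegree_sub_C]
    refine ⟨rfl, fun b hb => h b ?_⟩
    rw [mem_roots hne, IsRoot, eval_sub, eval_C, sub_eq_zero] at hb
    exact hb
  have hlc : (φ - C w).leadingCoeff = φ.leadingCoeff :=
    leadingCoeff_sub_of_degree_lt
      (degree_C_le.trans_lt (natDegree_pos_iff_degree_pos.1 (Nat.pos_of_ne_zero hd)))
  have := hs.eval_eq_prod_roots z
  rw [hroots, hlc, Multiset.map_replicate, Multiset.prod_replicate, eval_sub, eval_C] at this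
  rw [this, norm_mul, norm_pow]

theorem filledJulia_infinite [IsAlgClosed L] (hnt : ∃ x : L, 1 < ‖x‖) (hd : 2 ≤ φ.natDegree) :
    (filledJulia φ).Infinite := by
  obtain ⟨x, hx⟩ : ∃ x, φ.eval x = x := by
    have hdeg : (φ - X).natDegree = φ.natDegree :=
      natDegree_sub_eq_left_of_natDegree_lt (by rw [natDegree_X]; omega)
    obtain ⟨x, hx⟩ := IsAlgClosed.exists_root (φ - X) (by
      intro h
      have := natDegree_eq_zero_iff_degree_le_zero.2 h.le
      omega)
    exact ⟨x, by simpa [sub_eq_zero] using hx⟩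
  have hfix : ∀ n, polyIter φ n x = x := fun n => Function.iterate_fixed hx n
  have hxF : x ∈ filledJulia φ := mem_filledJulia_of_bounded (B := ‖x‖) fun n => by rw [hfix]
  by_cases hu : ∀ y, φ.eval y = x → y = x
  · let _ : NontriviallyNormedField L := { ‹NormedField L› with non_trivial := hnt }
    have hpow := norm_eval_sub_of_unique_preimage (by omega) hu
    set a := ‖φ.leadingCoeff‖ with ha
    have ha0 : 0 ≤ a := norm_nonneg _
    set δ : ℝ := (a + 1)⁻¹ with hδ
    have hδ0 : 0 < δ := by positivity
    have hδ1 : δ ≤ 1 := inv_le_one_of_one_le₀ (by linarith)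
    have haδ : a * δ ≤ 1 := by
      rw [hδ, mul_inv_le_iff₀ (by positivity)]
      linarith
    refine (infinite_of_mem_nhds x (Metric.closedBall_mem_nhds x hδ0)).mono fun z hz => ?_
    rw [mem_closedBall_iff_norm] at hz
    have hb : ∀ n, ‖polyIter φ n z - x‖ ≤ δ := by
      intro n
      induction n with
      | zero => simpa [polyIter] using hz
      | succ n ih =>
        have h1 : polyIter φ (n + 1) z = φ.eval (polyIter φ n z) := by
          simp [polyIter, Function.iterate_succ_apply']
        rw [h1, hpow]
        calc a * ‖polyIter φ n z - x‖ ^ φ.natDegree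
            ≤ a * ‖polyIter φ n z - x‖ ^ 2 := by
              gcongr ?_ * ?_
              exact pow_le_pow_of_le_one (norm_nonneg _) (ih.trans hδ1) hd
          _ ≤ a * δ ^ 2 := by gcongr
          _ = (a * δ) * δ := by ring
          _ ≤ δ := mul_le_of_le_one_left hδ0.le haδ
    refine mem_filledJulia_of_bounded (B := δ + ‖x‖) fun n => ?_
    calc ‖polyIter φ n z‖ = ‖(polyIter φ n z - x) + x‖ := by rw [sub_add_cancel]
      _ ≤ _ := (norm_add_le _ _).trans (by linarith [hb n])
  · push Not at hu
    obtain ⟨y, hyx, hne⟩ := hu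
    have hsurj : ∀ w : L, ∃ z, φ.eval z = w := fun w => by
      obtain ⟨z, hz⟩ := IsAlgClosed.exists_root (φ - C w) (by
        intro h
        have := natDegree_eq_zero_iff_degree_le_zero.2 h.le
        rw [natDegree_sub_C] at this
        omega)
      exact ⟨z, by simpa [sub_eq_zero] using hz⟩
    choose g hg using hsurj
    have hback : ∀ m, polyIter φ m (g^[m] y) = y := fun m =>
      (Function.LeftInverse.iterate (f := g) (g := fun w => φ.eval w) hg m) y
    have hnot : ∀ m l, m < l → g^[m] y ≠ g^[l] y := by
      intro m l hml heq
      have h1 : polyIter φ l (g^[m] y) = y := by rw [heq]; exact hback l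
      obtain ⟨e, rfl⟩ : ∃ e, l = e + 1 + m := ⟨l - m - 1, by omega⟩
      apply hne
      rw [← h1]
      have h2 : polyIter φ (e + 1 + m) (g^[m] y) = polyIter φ (e + 1) (polyIter φ m (g^[m] y)) := by
        simp [polyIter, Function.iterate_add_apply]
      have h3 : polyIter φ (e + 1) y = polyIter φ e (φ.eval y) := by
        simp [polyIter]
      rw [h2, hback, h3, hyx, hfix]
    refine Set.infinite_of_injective_forall_mem (f := fun m => g^[m] y) ?_ fun m => ?_
    · intro m l h
      by_contra hml
      rcases lt_or_gt_of_ne hml with h' | h'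
      · exact hnot _ _ h' h
      · exact hnot _ _ h' h.symm
    · rw [← polyIter_mem_filledJulia_iff (m + 1)]
      have : polyIter φ (m + 1) (g^[m] y) = φ.eval (polyIter φ m (g^[m] y)) := by
        simp [polyIter, Function.iterate_succ_apply']
      rw [this, hback, hyx]
      exact hxF

/-- Up to powers of the leading coefficients, the product of the values of `q` at the roots of `p`
equals the product of the values of `p` at the roots of `q`. -/
theorem norm_prod_eval_roots [IsAlgClosed L] {p q : L[X]} (hq : q.Monic) :
    ‖p.leadingCoeff‖ ^ q.natDegree * (p.roots.map fun x => ‖q.eval x‖).prod =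
      (q.roots.map fun y => ‖p.eval y‖).prod := by
  have hn : ∀ (s : Multiset L) (f : L → L), ‖(s.map f).prod‖ = (s.map fun x => ‖f x‖).prod := by
    intro s f
    simpa using map_multiset_prod (normHom : L →*₀ ℝ) (s.map f)
  have h1 : ∀ x, ‖q.eval x‖ = (q.roots.map fun y => ‖x - y‖).prod := fun x => by
    rw [(IsAlgClosed.splits q).eval_eq_prod_roots_of_monic hq, hn]
  have h2 : ∀ y, ‖p.eval y‖ = ‖p.leadingCoeff‖ * (p.roots.map fun x => ‖x - y‖).prod := fun y => by
    rw [(IsAlgClosed.splits p).eval_eq_prod_roots, norm_mul, hn]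
    simp only [norm_sub_rev]
  simp only [h1, h2]
  rw [Multiset.prod_map_mul, Multiset.map_const', Multiset.prod_replicate,
    ← (IsAlgClosed.splits q).natDegree_eq_card_roots, Multiset.prod_map_prod_map]

/-- The values of a monic polynomial on a finite set exceeding its degree in size cannot all be
small. -/
theorem exists_pos_le_norm_eval_of_monic (T : Finset L) :
    ∃ ε : ℝ, 0 < ε ∧ ∀ q : L[X], q.Monic → T.card = q.natDegree + 1 →
      ∃ x ∈ T, ε ≤ ‖q.eval x‖ := by
  classical
  set S : ℝ := ∑ x ∈ T, ‖∏ y ∈ T.erase x, (x - y)‖⁻¹ with hS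
  have hS0 : 0 ≤ S := Finset.sum_nonneg fun _ _ => by positivity
  refine ⟨(S + 1)⁻¹, by positivity, fun q hq hc => ?_⟩
  by_contra! hlt
  have h := Lagrange.leadingCoeff_eq_sum (s := T) (v := id) Function.injective_id.injOn (P := q)
    (by rw [degree_eq_natDegree hq.ne_zero, hc]; rfl)
  rw [hq.leadingCoeff] at h
  have h1 : (1 : ℝ) ≤ (S + 1)⁻¹ * S := by
    calc (1 : ℝ) = ‖(1 : L)‖ := norm_one.symm
      _ ≤ ∑ x ∈ T, ‖q.eval x‖ * ‖∏ y ∈ T.erase x, (x - y)‖⁻¹ := by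
        rw [h]
        refine (norm_sum_le _ _).trans (le_of_eq ?_)
        simp [div_eq_mul_inv]
      _ ≤ ∑ x ∈ T, (S + 1)⁻¹ * ‖∏ y ∈ T.erase x, (x - y)‖⁻¹ :=
        Finset.sum_le_sum fun x hx =>
          mul_le_mul_of_nonneg_right (hlt x hx).le (by positivity)
      _ = (S + 1)⁻¹ * S := by rw [hS, Finset.mul_sum]
  rw [inv_mul_eq_div, le_div_iff₀ (by positivity)] at h1
  linarith

/-- Monic polynomials of degree `n` have supremum norm at least `r ^ n` on the filled Julia set. -/
theorem exists_mem_filledJulia_pow_le [IsAlgClosed L] (hnt : ∃ x : L, 1 < ‖x‖)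
    (hd : 2 ≤ φ.natDegree) {r : ℝ} (hr0 : 0 < r) (hr : ‖φ.leadingCoeff‖ * r ^ φ.natDegree = r)
    {s : ℝ} (hs0 : 0 < s) (hsr : s < r) {q : L[X]} (hq : q.Monic) :
    ∃ z ∈ filledJulia φ, s ^ q.natDegree ≤ ‖q.eval z‖ := by
  set n := q.natDegree with hn
  have hinf := filledJulia_infinite hnt hd
  rcases Nat.eq_zero_or_pos n with h0 | hpos
  · obtain ⟨z, hz⟩ := hinf.nonempty
    refine ⟨z, hz, ?_⟩
    have : q = 1 := hq.natDegree_eq_zero.1 (hn ▸ h0)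
    simp [h0, this]
  by_contra! hlt
  obtain ⟨T, hTF, hTc⟩ := hinf.exists_subset_card_eq (n + 1)
  obtain ⟨ε, hε, hT⟩ := exists_pos_le_norm_eval_of_monic T
  have hbound : ∀ k, ε ≤ r ^ n * (s / r) ^ k := by
    intro k
    set P := iterPoly φ k with hP
    set N := φ.natDegree ^ k with hN
    have hNd : P.natDegree = N := iterPoly.natDegree_eq φ k
    have hNpos : 0 < N := pow_pos (by omega) k
    obtain ⟨w, hwT, hw⟩ := hT (q.roots.map fun y => X - C (P.eval y)).prod
      (monic_multiset_prod_of_monic _ _ fun y _ => monic_X_sub_C _) (by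
        rw [hTc, natDegree_multiset_prod_of_monic _ (by
          intro p hp
          obtain ⟨y, -, rfl⟩ := Multiset.mem_map.1 hp
          exact monic_X_sub_C _)]
        simp [← (IsAlgClosed.splits q).natDegree_eq_card_roots, hn])
    refine hw.trans ?_
    have hwF : w ∈ filledJulia φ := hTF hwT
    have hPw : P - C w ≠ 0 := fun h => by
      have := natDegree_sub_C (p := P) (a := w)
      rw [h, natDegree_zero] at this
      omega
    have hlc : (P - C w).leadingCoeff = P.leadingCoeff :=
      leadingCoeff_sub_of_degree_lt
        (degree_C_le.trans_lt (natDegree_pos_iff_degree_pos.1 (by omega)))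
    have e1 : ‖((q.roots.map fun y => X - C (P.eval y)).prod).eval w‖ =
        (q.roots.map fun y => ‖(P - C w).eval y‖).prod := by
      rw [eval_multiset_prod, Multiset.map_map]
      have := map_multiset_prod (normHom : L →*₀ ℝ)
        (q.roots.map (eval w ∘ fun y => X - C (P.eval y)))
      rw [Multiset.map_map] at this
      simpa [norm_sub_rev] using this
    rw [e1, ← norm_prod_eval_roots hq, hlc, ← hn]
    have e2 : ((P - C w).roots.map fun x => ‖q.eval x‖).prod ≤ (s ^ n) ^ N := by
      calc ((P - C w).roots.map fun x => ‖q.eval x‖).prod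
          ≤ ((P - C w).roots.map fun _ => s ^ n).prod := by
            refine Multiset.prod_map_le_prod_map₀ _ _ (fun _ _ => norm_nonneg _) fun x hx => ?_
            refine (hlt x ?_).le
            rw [mem_roots hPw, IsRoot, eval_sub, eval_C, sub_eq_zero, hP, iterPoly.eval_eq] at hx
            rw [← polyIter_mem_filledJulia_iff k, hx]
            exact hwF
        _ = (s ^ n) ^ N := by
            rw [Multiset.map_const', Multiset.prod_replicate,
              ← (IsAlgClosed.splits (P - C w)).natDegree_eq_card_roots, natDegree_sub_C, hNd]
    have e3 : ‖P.leadingCoeff‖ * r ^ N = r :=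
      iterPoly.norm_leadingCoeff_mul_pow (by omega) hr k
    calc ‖P.leadingCoeff‖ ^ n * ((P - C w).roots.map fun x => ‖q.eval x‖).prod
        ≤ ‖P.leadingCoeff‖ ^ n * (s ^ n) ^ N := by gcongr
      _ = (‖P.leadingCoeff‖ * r ^ N) ^ n * (s / r) ^ (n * N) := by
          rw [div_pow, mul_pow, ← pow_mul, ← pow_mul, mul_comm N n]
          field_simp
      _ ≤ r ^ n * (s / r) ^ k := by
          rw [e3]
          refine mul_le_mul_of_nonneg_left ?_ (by positivity)
          refine pow_le_pow_of_le_one (by positivity) ((div_le_one hr0).2 hsr.le) ?_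
          calc k ≤ N := (Nat.lt_pow_self (by omega)).le
            _ ≤ n * N := Nat.le_mul_of_pos_left _ hpos
  have hlim : Tendsto (fun k : ℕ => r ^ n * (s / r) ^ k) atTop (nhds (r ^ n * 0)) :=
    (tendsto_pow_atTop_nhds_zero_of_lt_one (by positivity) ((div_lt_one hr0).2 hsr)).const_mul _
  rw [mul_zero] at hlim
  exact absurd (ge_of_tendsto' hlim hbound) (not_le.2 hε)

/-- Monic polynomials of every degree with almost minimal supremum norm on the filled Julia set. -/
theorem exists_monic_norm_eval_le (hd : 2 ≤ φ.natDegree) {r : ℝ} (hr0 : 0 < r)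
    (hr : ‖φ.leadingCoeff‖ * r ^ φ.natDegree = r) {s : ℝ} (hrs : r < s) :
    ∃ B : ℝ, 0 < B ∧ ∀ l : ℕ, ∃ q : L[X], q.Monic ∧ q.natDegree = l ∧
      ∀ z ∈ filledJulia φ, ‖q.eval z‖ ≤ B * s ^ l := by
  have hs0 : 0 < s := hr0.trans hrs
  obtain ⟨R, hR1, hR⟩ := exists_escape_radius hd
  have hR0 : 0 < R := by linarith
  obtain ⟨k, hk⟩ := exists_pow_lt_of_lt_one (div_pos hr0 hR0) ((div_lt_one hs0).2 hrs)
  set P := iterPoly φ k with hP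
  set N := φ.natDegree ^ k with hN
  have hNd : P.natDegree = N := iterPoly.natDegree_eq φ k
  have hNpos : 0 < N := pow_pos (by omega) k
  have hP0 : P.leadingCoeff ≠ 0 := by
    rw [leadingCoeff_ne_zero]
    rintro h
    rw [h, natDegree_zero] at hNd
    omega
  have hPn : 0 < ‖P.leadingCoeff‖ := norm_pos_iff.2 hP0
  have e3 : ‖P.leadingCoeff‖ * r ^ N = r := iterPoly.norm_leadingCoeff_mul_pow (by omega) hr k
  have hquot : ‖P.leadingCoeff‖⁻¹ * R ≤ s ^ N := by
    have h1 : (r / s) ^ N < r / R :=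
      (pow_le_pow_of_le_one (by positivity) ((div_le_one hs0).2 hrs.le)
        (Nat.lt_pow_self (by omega)).le).trans_lt hk
    rw [div_pow, div_lt_div_iff₀ (by positivity) hR0] at h1
    rw [inv_mul_le_iff₀ hPn]
    have h2 : r ^ N * R < r ^ N * (‖P.leadingCoeff‖ * s ^ N) := by
      calc r ^ N * R < r * s ^ N := h1
        _ = r ^ N * (‖P.leadingCoeff‖ * s ^ N) := by
          conv_lhs => rw [← e3]
          ring
    exact (lt_of_mul_lt_mul_left h2 (by positivity)).le
  have hm : (C P.leadingCoeff⁻¹ * P).Monic := by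
    rw [Monic, leadingCoeff_mul, leadingCoeff_C, inv_mul_cancel₀ hP0]
  refine ⟨(max 1 (R / s)) ^ N, by positivity, fun l => ?_⟩
  refine ⟨X ^ (l % N) * (C P.leadingCoeff⁻¹ * P) ^ (l / N), (monic_X_pow _).mul (hm.pow _), ?_, ?_⟩
  · rw [(monic_X_pow _).natDegree_mul (hm.pow _), hm.natDegree_pow, natDegree_X_pow,
      natDegree_C_mul (inv_ne_zero hP0), hNd]
    exact Nat.mod_add_div' l N
  · intro z hz
    have hz1 : ‖z‖ ≤ R := norm_le_of_mem_filledJulia hR1 hR hz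
    have hz2 : ‖P.eval z‖ ≤ R := by
      rw [hP, iterPoly.eval_eq]
      exact norm_le_of_mem_filledJulia hR1 hR ((polyIter_mem_filledJulia_iff k z).2 hz)
    have hl : s ^ l = s ^ (l % N) * (s ^ N) ^ (l / N) := by
      rw [← pow_mul, ← pow_add, Nat.mod_add_div]
    simp only [eval_mul, eval_pow, eval_X, eval_C, norm_mul, norm_pow, norm_inv]
    calc ‖z‖ ^ (l % N) * (‖P.leadingCoeff‖⁻¹ * ‖P.eval z‖) ^ (l / N)
        ≤ R ^ (l % N) * (‖P.leadingCoeff‖⁻¹ * R) ^ (l / N) := by gcongr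
      _ ≤ R ^ (l % N) * (s ^ N) ^ (l / N) := by gcongr
      _ = (R / s) ^ (l % N) * s ^ l := by
          rw [hl, div_pow]
          field_simp
      _ ≤ (max 1 (R / s)) ^ (l % N) * s ^ l := by
          gcongr
          exact le_max_right _ _
      _ ≤ (max 1 (R / s)) ^ N * s ^ l := by
          gcongr
          · exact le_max_left _ _
          · exact (Nat.mod_lt _ hNpos).le

end FilledJulia

section TransfiniteDiameter

open Polynomial

variable {L : Type*} [NormedField L]

theorem pairDistProd_nonneg {n : ℕ} (x : Fin n → L) :
    0 ≤ pairDistProd (fun x y => ‖x - y‖) x :=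
  Finset.prod_nonneg fun i _ => Finset.prod_nonneg fun j _ => by split_ifs <;> positivity

theorem pairDistProd_succ {n : ℕ} (x : Fin (n + 1) → L) :
    pairDistProd (fun x y => ‖x - y‖) x =
      (∏ j : Fin n, ‖x 0 - x j.succ‖) ^ 2 *
        pairDistProd (fun x y => ‖x - y‖) (fun j => x j.succ) := by
  unfold pairDistProd
  rw [Fin.prod_univ_succ]
  simp_rw [Fin.prod_univ_succ (n := n)]
  simp only [if_true, one_mul, Fin.succ_ne_zero, (Fin.succ_ne_zero _).symm, if_false,
    Fin.succ_inj, Finset.prod_mul_distrib]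
  simp_rw [norm_sub_rev _ (x 0)]
  ring

theorem pairDistProd_eq_norm_det_vandermonde_sq {n : ℕ} (x : Fin n → L) :
    pairDistProd (fun x y => ‖x - y‖) x = ‖(Matrix.vandermonde x).det‖ ^ 2 := by
  rw [Matrix.det_vandermonde]
  induction n with
  | zero => simp [pairDistProd]
  | succ n ih =>
    rw [pairDistProd_succ, ih, Fin.prod_univ_succ, Fin.prod_Ioi_zero]
    simp only [Fin.prod_Ioi_succ, norm_mul, norm_prod, norm_sub_rev (x 0), mul_pow]

theorem norm_det_le_factorial_mul_prod {n : ℕ} (M : Matrix (Fin n) (Fin n) L) {b : Fin n → ℝ}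
    (h : ∀ i j, ‖M i j‖ ≤ b j) : ‖M.det‖ ≤ n.factorial * ∏ j, b j := by
  rw [Matrix.det_apply]
  calc ‖∑ σ : Equiv.Perm (Fin n), Equiv.Perm.sign σ • ∏ i, M (σ i) i‖
      ≤ ∑ _σ : Equiv.Perm (Fin n), ∏ j, b j := by
        refine norm_sum_le_of_le _ fun σ _ => ?_
        have : ‖Equiv.Perm.sign σ • ∏ i, M (σ i) i‖ = ∏ i, ‖M (σ i) i‖ := by
          rcases Int.units_eq_one_or (Equiv.Perm.sign σ) with hσ | hσ <;>
            simp [hσ, norm_prod, Units.smul_def]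
        rw [this]
        exact Finset.prod_le_prod (fun _ _ => norm_nonneg _) fun i _ => h _ _
    _ = n.factorial * ∏ j, b j := by
        simp [Fintype.card_perm]

theorem pairDistProd_le_of_monic {F : Set L} {B s : ℝ} (hB : 0 < B) (hs : 0 < s)
    (h : ∀ l : ℕ, ∃ q : L[X], q.Monic ∧ q.natDegree = l ∧ ∀ z ∈ F, ‖q.eval z‖ ≤ B * s ^ l)
    {n : ℕ} (x : Fin n → L) (hx : ∀ i, x i ∈ F) :
    pairDistProd (fun x y => ‖x - y‖) x ≤ (n * B) ^ (2 * n) * s ^ (n * (n - 1)) := by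
  choose q hqm hqd hq using h
  have hdet := Matrix.det_eval_matrixOfPolynomials_eq_det_vandermonde x (fun j : Fin n => q j)
    (fun i => hqd i) (fun i => hqm i)
  rw [pairDistProd_eq_norm_det_vandermonde_sq, hdet]
  have h1 := norm_det_le_factorial_mul_prod
    (Matrix.of fun i j : Fin n => eval (x i) (q j)) (b := fun j => B * s ^ (j : ℕ))
    (fun i j => hq _ _ (hx i))
  have h2 : ∏ j : Fin n, B * s ^ (j : ℕ) = B ^ n * s ^ (∑ j ∈ Finset.range n, j) := by
    rw [Finset.prod_mul_distrib, Finset.prod_pow_eq_pow_sum, Fin.sum_univ_eq_sum_range (fun j => j)]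
    simp
  have h3 : (n.factorial : ℝ) ≤ (n : ℝ) ^ n := by exact_mod_cast n.factorial_le_pow
  rw [h2] at h1
  calc _ ≤ ((n.factorial : ℝ) * (B ^ n * s ^ (∑ j ∈ Finset.range n, j))) ^ 2 := by gcongr
    _ ≤ ((n : ℝ) ^ n * (B ^ n * s ^ (∑ j ∈ Finset.range n, j))) ^ 2 := by gcongr
    _ = (n * B) ^ (2 * n) * s ^ ((∑ j ∈ Finset.range n, j) * 2) := by
        rw [pow_mul s, mul_comm 2 n, pow_mul _ n 2, mul_pow _ B n]
        ring
    _ = _ := by rw [Finset.sum_range_id_mul_two]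

theorem nthDiam_nonneg (F : Set L) (n : ℕ) : 0 ≤ nthDiam (fun x y => ‖x - y‖) F n := by
  refine Real.sSup_nonneg ?_
  rintro _ ⟨x, -, rfl⟩
  exact Real.rpow_nonneg (pairDistProd_nonneg x) _

theorem pow_rpow_inv_mul_sub_one {s : ℝ} (hs : 0 ≤ s) (m : ℕ) :
    (s ^ ((m + 2) * (m + 2 - 1))) ^ ((((m + 2 : ℕ) : ℝ) * (((m + 2 : ℕ) : ℝ) - 1))⁻¹) = s := by
  have h : (((m + 2 : ℕ) : ℝ) * (((m + 2 : ℕ) : ℝ) - 1)) = ((m + 2) * (m + 2 - 1) : ℕ) := by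
    have : m + 2 - 1 = m + 1 := by omega
    rw [this]
    push_cast
    ring
  rw [h, Real.pow_rpow_inv_natCast hs (by simp)]

theorem rpow_pairDistProd_le_of_monic {F : Set L} {B s : ℝ} (hB : 0 < B) (hs : 0 < s)
    (h : ∀ l : ℕ, ∃ q : L[X], q.Monic ∧ q.natDegree = l ∧ ∀ z ∈ F, ‖q.eval z‖ ≤ B * s ^ l)
    (m : ℕ) (x : Fin (m + 2) → L) (hx : ∀ i, x i ∈ F) :
    pairDistProd (fun x y => ‖x - y‖) x ^ ((((m + 2 : ℕ) : ℝ) * (((m + 2 : ℕ) : ℝ) - 1))⁻¹) ≤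
      (((m : ℝ) + 2) * B) ^ (2 / ((m : ℝ) + 1)) * s := by
  have hle := pairDistProd_le_of_monic hB hs h x hx
  have hexp : 0 ≤ (((m + 2 : ℕ) : ℝ) * (((m + 2 : ℕ) : ℝ) - 1))⁻¹ := by
    have : 0 ≤ ((m + 2 : ℕ) : ℝ) - 1 := by push_cast; linarith [m.cast_nonneg (α := ℝ)]
    positivity
  refine (Real.rpow_le_rpow (pairDistProd_nonneg x) hle hexp).trans (le_of_eq ?_)
  rw [Real.mul_rpow (by positivity) (by positivity), pow_rpow_inv_mul_sub_one hs.le]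
  congr 1
  rw [← Real.rpow_natCast, ← Real.rpow_mul (by positivity)]
  push_cast
  congr 1
  have h1 : (m : ℝ) + 2 - 1 ≠ 0 := by
    have : 0 ≤ (m : ℝ) := m.cast_nonneg
    intro h; linarith
  have h2 : (m : ℝ) + 1 ≠ 0 := by positivity
  field_simp
  ring

theorem transDiam_le_of_monic {F : Set L} {B s : ℝ} (hB : 0 < B) (hs : 0 < s)
    (h : ∀ l : ℕ, ∃ q : L[X], q.Monic ∧ q.natDegree = l ∧ ∀ z ∈ F, ‖q.eval z‖ ≤ B * s ^ l) :
    transDiam (fun x y => ‖x - y‖) F ≤ s := by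
  have hb : ∀ m : ℕ, transDiam (fun x y => ‖x - y‖) F ≤
      (((m : ℝ) + 2) * B) ^ (2 / ((m : ℝ) + 1)) * s := by
    intro m
    refine (ciInf_le ⟨0, ?_⟩ m).trans (Real.sSup_le ?_ (by positivity))
    · rintro _ ⟨n, rfl⟩
      exact nthDiam_nonneg F _
    · rintro _ ⟨x, hx, rfl⟩
      exact rpow_pairDistProd_le_of_monic hB hs h m x hx
  have hlim : Tendsto (fun m : ℕ => (((m : ℝ) + 2) * B) ^ (2 / ((m : ℝ) + 1)) * s) atTop
      (nhds (1 * s)) := by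
    refine Tendsto.mul_const s ?_
    have h1 : Tendsto (fun m : ℕ => ((m : ℝ) + 2) * B) atTop atTop :=
      (tendsto_atTop_add_const_right _ _ tendsto_natCast_atTop_atTop).atTop_mul_const hB
    refine ((tendsto_rpow_div_mul_add 2 B⁻¹ (-1) (by positivity)).comp h1).congr fun m => ?_
    simp only [Function.comp]
    congr 2
    field_simp
    ring
  rw [one_mul] at hlim
  exact ge_of_tendsto' hlim hb

theorem le_transDiam_of_monic {F : Set L} {B t s : ℝ} (hB : 0 < B) (ht : 0 < t) (hs : 0 < s)
    (hup : ∀ l : ℕ, ∃ q : L[X], q.Monic ∧ q.natDegree = l ∧ ∀ z ∈ F, ‖q.eval z‖ ≤ B * t ^ l)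
    (h : ∀ q : L[X], q.Monic → ∃ z ∈ F, s ^ q.natDegree ≤ ‖q.eval z‖) :
    s ≤ transDiam (fun x y => ‖x - y‖) F := by
  have hx : ∀ n : ℕ, ∃ x : Fin n → L, (∀ i, x i ∈ F) ∧
      s ^ (n * (n - 1)) ≤ pairDistProd (fun x y => ‖x - y‖) x := by
    intro n
    induction n with
    | zero => exact ⟨Fin.elim0, fun i => i.elim0, by simp [pairDistProd]⟩
    | succ n ih =>
      obtain ⟨x, hxF, hx⟩ := ih
      obtain ⟨z, hzF, hz⟩ := h (∏ i, (X - C (x i))) (monic_prod_of_monic _ _ fun i _ =>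
        monic_X_sub_C _)
      refine ⟨Fin.cons z x, fun i => ?_, ?_⟩
      · refine Fin.cases ?_ (fun j => ?_) i
        · simpa using hzF
        · simpa using hxF j
      · rw [pairDistProd_succ]
        simp only [Fin.cons_zero, Fin.cons_succ]
        rw [natDegree_prod_of_monic _ _ fun i _ => monic_X_sub_C _] at hz
        simp only [natDegree_X_sub_C, Finset.sum_const, Finset.card_univ, Fintype.card_fin,
          smul_eq_mul, mul_one, eval_prod, eval_sub, eval_X, eval_C, norm_prod] at hz
        have he : (n + 1) * (n + 1 - 1) = n * 2 + n * (n - 1) := by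
          cases n with
          | zero => rfl
          | succ n => simp only [Nat.add_sub_cancel]; ring
        rw [he, pow_add, pow_mul]
        gcongr
  refine le_ciInf fun m => ?_
  obtain ⟨x, hxF, hx⟩ := hx (m + 2)
  have hbdd : BddAbove {r : ℝ | ∃ x : Fin (m + 2) → L, (∀ i, x i ∈ F) ∧
      r = pairDistProd (fun x y => ‖x - y‖) x ^
        ((((m + 2 : ℕ) : ℝ) * (((m + 2 : ℕ) : ℝ) - 1))⁻¹)} := by
    refine ⟨(((m : ℝ) + 2) * B) ^ (2 / ((m : ℝ) + 1)) * t, ?_⟩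
    rintro _ ⟨y, hy, rfl⟩
    exact rpow_pairDistProd_le_of_monic hB ht hup m y hy
  refine le_trans ?_ (le_csSup hbdd ⟨x, hxF, rfl⟩)
  have hexp : 0 ≤ (((m + 2 : ℕ) : ℝ) * (((m + 2 : ℕ) : ℝ) - 1))⁻¹ := by
    have : 0 ≤ ((m + 2 : ℕ) : ℝ) - 1 := by push_cast; linarith [m.cast_nonneg (α := ℝ)]
    positivity
  calc s = _ := (pow_rpow_inv_mul_sub_one hs.le m).symm
    _ ≤ _ := Real.rpow_le_rpow (by positivity) hx hexp

/-- The transfinite diameter of the filled Julia set of a polynomial of degree `d ≥ 2` with leading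
coefficient `a` is `|a| ^ (-1 / (d - 1))`. -/
theorem transDiam_filledJulia [IsAlgClosed L] (hnt : ∃ x : L, 1 < ‖x‖) {φ : L[X]}
    (hd : 2 ≤ φ.natDegree) :
    transDiam (fun x y => ‖x - y‖) (filledJulia φ) =
      ‖φ.leadingCoeff‖ ^ (-((φ.natDegree : ℝ) - 1)⁻¹) := by
  have ha : 0 < ‖φ.leadingCoeff‖ := by
    rw [norm_pos_iff, leadingCoeff_ne_zero]
    rintro rfl
    simp at hd
  set r : ℝ := ‖φ.leadingCoeff‖ ^ (-((φ.natDegree : ℝ) - 1)⁻¹) with hrdef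
  have hr0 : 0 < r := Real.rpow_pos_of_pos ha _
  have hd' : (φ.natDegree : ℝ) - 1 ≠ 0 := by
    have : (2 : ℝ) ≤ φ.natDegree := by exact_mod_cast hd
    linarith
  have hr : ‖φ.leadingCoeff‖ * r ^ φ.natDegree = r := by
    have he : 1 + -((φ.natDegree : ℝ) - 1)⁻¹ * φ.natDegree = -((φ.natDegree : ℝ) - 1)⁻¹ := by
      field_simp
      ring
    rw [hrdef, ← Real.rpow_natCast, ← Real.rpow_mul ha.le, ← Real.rpow_one_add' ha.le, he]
    rw [he]
    exact neg_ne_zero.2 (inv_ne_zero hd')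
  apply le_antisymm
  · refine le_of_forall_gt_imp_ge_of_dense fun s hs => ?_
    obtain ⟨B, hB, h⟩ := exists_monic_norm_eval_le hd hr0 hr hs
    exact transDiam_le_of_monic hB (hr0.trans hs) h
  · refine le_of_forall_lt_imp_le_of_dense fun s hs => ?_
    obtain ⟨B, hB, h⟩ := exists_monic_norm_eval_le hd hr0 hr (lt_add_one r)
    rcases le_or_gt s 0 with hs0 | hs0
    · exact hs0.trans (Real.iInf_nonneg fun n => nthDiam_nonneg _ _)
    · exact le_transDiam_of_monic hB (by positivity) hs0 h fun q hq =>
        exists_mem_filledJulia_pow_le hnt hd hr0 hr hs0 hs hq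

end TransfiniteDiameter

/-- Let `K` be a number field and `φ ∈ K[z]` of degree `d ≥ 2`.  For each
place `v` let `F_v ⊆ C_v` be the filled Julia set of `φ` over `C_v` and `c(F_v)` its
transfinite diameter with respect to `|·|_v`.  Then `c(F_v)^{n_v} = 1` for all but finitely
many `v`, and `∏_v c(F_v)^{n_v} = 1`. -/
theorem stmt1 {K : Type} [Field K] [NumberField K] (A : AdelicData K)
    (hN : A.Northcott) (φ : Polynomial K) (hd : 2 ≤ φ.natDegree) :
    {v : A.V | transDiam (fun x y => ‖x - y‖)
        (filledJulia (φ.map (A.embK v))) ^ A.nv v ≠ 1}.Finite ∧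
    ∏ᶠ v : A.V, transDiam (fun x y => ‖x - y‖)
        (filledJulia (φ.map (A.embK v))) ^ A.nv v = 1 := by
  have hφ : φ.leadingCoeff ≠ 0 := by
    rw [Polynomial.leadingCoeff_ne_zero]
    rintro rfl
    simp at hd
  set e : ℝ := -((φ.natDegree : ℝ) - 1)⁻¹ with he
  set f : A.V → ℝ := fun v =>
    ‖A.emb v (algebraMap K (AlgebraicClosure K) φ.leadingCoeff)‖ ^ A.nv v with hf
  have hf0 : ∀ v, 0 < f v := fun v =>
    Real.rpow_pos_of_pos (norm_pos_iff.2 (by simpa using hφ)) _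
  have hc : ∀ v, transDiam (fun x y => ‖x - y‖) (filledJulia (φ.map (A.embK v))) ^ A.nv v =
      f v ^ e := fun v => by
    rw [transDiam_filledJulia (A.C v).nontrivial (by rwa [Polynomial.natDegree_map]),
      Polynomial.leadingCoeff_map, Polynomial.natDegree_map, hf, ← Real.rpow_mul (norm_nonneg _),
      ← Real.rpow_mul (norm_nonneg _), mul_comm]
    rfl
  have hfin : {v : A.V | f v ≠ 1}.Finite :=
    (A.finite_support _ hφ).subset fun v hv h => hv (by simp only [hf]; rw [h, Real.one_rpow])
  have hsub : {v : A.V | f v ^ e ≠ 1} ⊆ {v : A.V | f v ≠ 1} := fun v hv h =>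
    hv (by rw [h, Real.one_rpow])
  simp only [hc]
  refine ⟨hfin.subset hsub, ?_⟩
  have hprod : ∏ᶠ v, f v = 1 := A.product_formula _ hφ
  have h1 : Function.mulSupport f ⊆ hfin.toFinset := fun v hv => by simpa using hv
  have h2 : (Function.mulSupport fun v => f v ^ e) ⊆ hfin.toFinset := fun v hv => by
    simpa using hsub hv
  rw [finprod_eq_prod_of_mulSupport_subset _ h1] at hprod
  rw [finprod_eq_prod_of_mulSupport_subset _ h2, Real.finsetProd_rpow _ _ fun v _ => (hf0 v).le,
    hprod, Real.one_rpow]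
end

section
/- Let L be an algebraically closed field equipped with an absolute value |·|, let A ⊆ L be a bounded subset, and let φ ∈ L[z] be a polynomial of degree d ≥ 1 with leading coefficient a_d. Set A* := {z ∈ L : φ(z) ∈ A}. Then c(A*) = (c(A)/|a_d|)^{1/d}. -/
open Polynomial Filter Topology

section PairDistProd

variable {α : Type*} {d : α → α → ℝ}

lemma pairDistProd_nonneg_s2 (hd : ∀ x y, 0 ≤ d x y) {n : ℕ} (x : Fin n → α) :
    0 ≤ pairDistProd d x := by
  refine Finset.prod_nonneg fun i _ => Finset.prod_nonneg fun j _ => ?_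
  split_ifs
  · exact zero_le_one
  · exact hd _ _

lemma pairDistProd_cons {n : ℕ} (x₀ : α) (x : Fin n → α) :
    pairDistProd d (Fin.cons x₀ x : Fin (n + 1) → α) =
      (∏ i, d x₀ (x i)) * (∏ i, d (x i) x₀) * pairDistProd d x := by
  simp [pairDistProd, Fin.prod_univ_succ, Fin.succ_ne_zero, (Fin.succ_ne_zero _).symm,
    Finset.prod_mul_distrib, mul_assoc]

lemma pairDistProd_le_pow {A : Set α} {K : ℝ} (hd : ∀ x y, 0 ≤ d x y) (hK : 1 ≤ K)
    (hA : ∀ x ∈ A, ∀ y ∈ A, d x y ≤ K) {n : ℕ} {x : Fin n → α} (hx : ∀ i, x i ∈ A) :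
    pairDistProd d x ≤ K ^ (n * n) := by
  have key : ∀ i j, 0 ≤ (if i = j then 1 else d (x i) (x j)) ∧
      (if i = j then 1 else d (x i) (x j)) ≤ K := by
    intro i j
    split_ifs
    · exact ⟨zero_le_one, hK⟩
    · exact ⟨hd _ _, hA _ (hx i) _ (hx j)⟩
  calc pairDistProd d x ≤ ∏ _i : Fin n, ∏ _j : Fin n, K :=
        Finset.prod_le_prod (fun i _ => Finset.prod_nonneg fun j _ => (key i j).1)
          fun i _ => Finset.prod_le_prod (fun j _ => (key i j).1) fun j _ => (key i j).2
    _ = K ^ (n * n) := by simp [pow_mul]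

lemma nthDiam_nonneg_s2 (hd : ∀ x y, 0 ≤ d x y) (A : Set α) (n : ℕ) : 0 ≤ nthDiam d A n := by
  refine Real.sSup_nonneg ?_
  rintro r ⟨x, -, rfl⟩
  exact Real.rpow_nonneg (pairDistProd_nonneg_s2 hd x) _

lemma transDiam_nonneg (hd : ∀ x y, 0 ≤ d x y) (A : Set α) : 0 ≤ transDiam d A :=
  Real.iInf_nonneg fun _ => nthDiam_nonneg_s2 hd A _

lemma transDiam_le_nthDiam (hd : ∀ x y, 0 ≤ d x y) (A : Set α) {n : ℕ} (hn : 2 ≤ n) :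
    transDiam d A ≤ nthDiam d A n := by
  obtain ⟨k, rfl⟩ := Nat.exists_eq_add_of_le' hn
  refine ciInf_le ⟨0, ?_⟩ k
  rintro _ ⟨n, rfl⟩
  exact nthDiam_nonneg_s2 hd A _

lemma natCast_mul_pred_nonneg (n : ℕ) : (0 : ℝ) ≤ n * ((n : ℝ) - 1) := by
  rcases Nat.eq_zero_or_pos n with rfl | hn
  · simp
  · have : (1 : ℝ) ≤ n := by exact_mod_cast hn
    exact mul_nonneg (by linarith) (by linarith)

lemma le_nthDiam {A : Set α} {K : ℝ} (hd : ∀ x y, 0 ≤ d x y) (hK : 1 ≤ K)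
    (hA : ∀ x ∈ A, ∀ y ∈ A, d x y ≤ K) {n : ℕ} {x : Fin n → α} (hx : ∀ i, x i ∈ A) :
    pairDistProd d x ^ (((n : ℝ) * ((n : ℝ) - 1))⁻¹) ≤ nthDiam d A n := by
  refine le_csSup ⟨(K ^ (n * n)) ^ (((n : ℝ) * ((n : ℝ) - 1))⁻¹), ?_⟩ ⟨x, hx, rfl⟩
  rintro _ ⟨y, hy, rfl⟩
  exact Real.rpow_le_rpow (pairDistProd_nonneg_s2 hd y) (pairDistProd_le_pow hd hK hA hy)
    (inv_nonneg.2 (natCast_mul_pred_nonneg n))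

end PairDistProd

section AbsoluteValue

variable {L : Type*} [Field L] (v : AbsoluteValue L ℝ)

/-- If no monic polynomial of positive degree `m` is bounded by `t ^ m` on `A`, then `A` contains
point configurations of every size with pairwise distance product at least `t ^ (n * (n - 1))`. -/
lemma exists_pow_le_pairDistProd {A : Set L} {t : ℝ} (ht : 0 ≤ t)
    (H : ∀ p : L[X], p.Monic → 1 ≤ p.natDegree → ∃ x ∈ A, t ^ p.natDegree < v (p.eval x)) (n : ℕ) :
    ∃ x : Fin n → L, (∀ i, x i ∈ A) ∧
      t ^ (n * (n - 1)) ≤ pairDistProd (fun x y => v (x - y)) x := by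
  induction n with
  | zero => exact ⟨Fin.elim0, fun i => i.elim0, by simp [pairDistProd]⟩
  | succ n ih =>
    obtain ⟨x, hx, hxt⟩ := ih
    obtain ⟨x₀, hx₀, h⟩ : ∃ x₀ ∈ A, t ^ n ≤ ∏ i, v (x₀ - x i) := by
      rcases Nat.eq_zero_or_pos n with rfl | hn
      · obtain ⟨x₀, hx₀, -⟩ := H X monic_X (by simp)
        exact ⟨x₀, hx₀, by simp⟩
      · obtain ⟨x₀, hx₀, h⟩ := H (∏ i, (X - C (x i))) (monic_prod_X_sub_C _ _)
          (by rw [natDegree_finsetProd_X_sub_C_eq_card, Finset.card_fin]; exact hn)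
        rw [natDegree_finsetProd_X_sub_C_eq_card, eval_prod, map_prod] at h
        exact ⟨x₀, hx₀, by simpa using h.le⟩
    refine ⟨Fin.cons x₀ x, fun i => Fin.cases hx₀ hx i, ?_⟩
    rw [pairDistProd_cons]
    simp_rw [fun i => v.map_sub (x i) x₀]
    calc t ^ ((n + 1) * (n + 1 - 1)) = t ^ n * t ^ n * t ^ (n * (n - 1)) := by
          rw [← pow_add, ← pow_add]
          congr 1
          rcases n with _ | n
          · simp
          · simp only [Nat.add_sub_cancel]; ring
      _ ≤ _ := by
          have h0 : 0 ≤ t ^ n := pow_nonneg ht n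
          exact mul_le_mul (mul_le_mul h h h0 (h0.trans h)) hxt (pow_nonneg ht _)
            (mul_nonneg (h0.trans h) (h0.trans h))

lemma exists_sub_le_of_bounded {A : Set L} (hA : ∃ M : ℝ, ∀ x ∈ A, v x ≤ M) :
    ∃ K : ℝ, 1 ≤ K ∧ ∀ x ∈ A, ∀ y ∈ A, v (x - y) ≤ K := by
  obtain ⟨M, hM⟩ := hA
  refine ⟨max 1 (M + M), le_max_left _ _, fun x hx y hy => le_max_of_le_right ?_⟩
  calc v (x - y) ≤ v x + v y := by
        simpa [sub_eq_add_neg] using v.add_le x (-y)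
    _ ≤ M + M := add_le_add (hM x hx) (hM y hy)

/-- A number larger than the transfinite diameter is witnessed by a Chebyshev-type polynomial. -/
lemma exists_monic_of_transDiam_lt {A : Set L} (hA : ∃ M : ℝ, ∀ x ∈ A, v x ≤ M) {t : ℝ}
    (ht : transDiam (fun x y => v (x - y)) A < t) :
    ∃ p : L[X], p.Monic ∧ 1 ≤ p.natDegree ∧ ∀ x ∈ A, v (p.eval x) ≤ t ^ p.natDegree := by
  by_contra! H
  have hd : ∀ x y : L, 0 ≤ v (x - y) := fun _ _ => v.nonneg _
  have ht0 : 0 ≤ t := (transDiam_nonneg hd A).trans ht.le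
  obtain ⟨K, hK, hAK⟩ := exists_sub_le_of_bounded v hA
  refine ht.not_ge (le_ciInf fun n => ?_)
  obtain ⟨x, hx, h⟩ := exists_pow_le_pairDistProd v ht0 H (n + 2)
  refine le_trans ?_ (le_nthDiam hd hK hAK hx)
  have hcast : (((n + 2 : ℕ) : ℝ) * (((n + 2 : ℕ) : ℝ) - 1)) =
      (((n + 2) * (n + 2 - 1) : ℕ) : ℝ) := by
    rw [show n + 2 - 1 = n + 1 from rfl]
    push_cast
    ring
  rw [hcast]
  calc t = (t ^ ((n + 2) * (n + 2 - 1))) ^ ((((n + 2) * (n + 2 - 1) : ℕ) : ℝ)⁻¹) :=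
        (Real.pow_rpow_inv_natCast ht0 (by simp)).symm
    _ ≤ _ := Real.rpow_le_rpow (pow_nonneg ht0 _) h (by positivity)

lemma pairDistProd_eq_det_vandermonde_sq {n : ℕ} (x : Fin n → L) :
    pairDistProd (fun x y => v (x - y)) x = v (Matrix.vandermonde x).det ^ 2 := by
  rw [Matrix.det_vandermonde, map_prod]
  simp_rw [map_prod]
  rw [← Finset.prod_pow]
  simp_rw [← Finset.prod_pow]
  have h := Finset.prod_prod_Ioi_mul_eq_prod_prod_off_diag (fun i j : Fin n => v (x i - x j))
  have h' : ∏ i, ∏ j ∈ Finset.Ioi i, v (x j - x i) ^ 2 =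
      ∏ i, ∏ j ∈ Finset.Ioi i, v (x j - x i) * v (x i - x j) := by
    refine Finset.prod_congr rfl fun i _ => Finset.prod_congr rfl fun j _ => ?_
    rw [v.map_sub (x i) (x j), sq]
  rw [h', h, pairDistProd]
  refine Finset.prod_congr rfl fun i _ => ?_
  rw [← Finset.prod_subset (Finset.subset_univ ({i}ᶜ : Finset (Fin n)))]
  · refine Finset.prod_congr rfl fun j hj => ?_
    have : i ≠ j := by simpa [eq_comm] using hj
    rw [if_neg this, v.map_sub]
  · intro j _ hj
    have : i = j := by simpa [eq_comm] using hj
    rw [if_pos this]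

lemma det_le_factorial_mul_prod {n : ℕ} (M : Matrix (Fin n) (Fin n) L) (b : Fin n → ℝ)
    (h : ∀ i j, v (M i j) ≤ b j) : v M.det ≤ n.factorial * ∏ j, b j := by
  rw [Matrix.det_apply]
  refine (v.sum_le _ _).trans ?_
  calc ∑ σ : Equiv.Perm (Fin n), v (Equiv.Perm.sign σ • ∏ i, M (σ i) i)
      ≤ ∑ _σ : Equiv.Perm (Fin n), ∏ j, b j := by
        refine Finset.sum_le_sum fun σ _ => ?_
        rw [v.map_units_int_smul, map_prod]
        exact Finset.prod_le_prod (fun i _ => v.nonneg _) fun i _ => h _ _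
    _ = n.factorial * ∏ j, b j := by simp [Fintype.card_perm]

/-- The determinant bound for `pairDistProd` coming from the monic polynomials
`p ^ (j / m) * X ^ (j % m)`. -/
lemma pairDistProd_le_of_monic_s2 {A : Set L} {R B : ℝ} (hR : 1 ≤ R) (hAR : ∀ x ∈ A, v x ≤ R)
    {p : L[X]} (hp : p.Monic) (hm : 1 ≤ p.natDegree) (hB : 0 < B)
    (hpB : ∀ x ∈ A, v (p.eval x) ≤ B) {n : ℕ} {x : Fin n → L} (hx : ∀ i, x i ∈ A) :
    pairDistProd (fun x y => v (x - y)) x ≤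
      (n.factorial * ∏ j ∈ Finset.range n, (B ^ (j / p.natDegree) * R ^ p.natDegree)) ^ 2 := by
  rw [pairDistProd_eq_det_vandermonde_sq]
  have hdeg : ∀ i : Fin n,
      (p ^ ((i : ℕ) / p.natDegree) * X ^ ((i : ℕ) % p.natDegree)).natDegree = (i : ℕ) := by
    intro i
    rw [(hp.pow _).natDegree_mul (monic_X_pow _), hp.natDegree_pow, natDegree_X_pow]
    exact Nat.div_add_mod' _ _
  rw [Matrix.det_eval_matrixOfPolynomials_eq_det_vandermonde x
    (fun i : Fin n => p ^ ((i : ℕ) / p.natDegree) * X ^ ((i : ℕ) % p.natDegree))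
    hdeg (fun i => (hp.pow _).mul (monic_X_pow _))]
  refine pow_le_pow_left₀ (v.nonneg _) ?_ 2
  rw [← Fin.prod_univ_eq_prod_range (fun j => B ^ (j / p.natDegree) * R ^ p.natDegree) n]
  refine det_le_factorial_mul_prod v _ _ fun i j => ?_
  simp only [Matrix.of_apply, eval_mul, eval_pow, eval_X, map_mul, map_pow]
  refine mul_le_mul (pow_le_pow_left₀ (v.nonneg _) (hpB _ (hx i)) _) ?_
    (pow_nonneg (v.nonneg _) _) (pow_nonneg hB.le _)
  exact (pow_le_pow_left₀ (v.nonneg _) (hAR _ (hx i)) _).trans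
    (pow_le_pow_right₀ hR (Nat.mod_lt _ hm).le)

lemma prod_range_mul_pow_div_sq (B : ℝ) {m : ℕ} (hm : 1 ≤ m) (N : ℕ) :
    (∏ j ∈ Finset.range (N * m), B ^ (j / m)) ^ 2 = B ^ (m * (N * (N - 1))) := by
  induction N with
  | zero => simp
  | succ N ih =>
    rw [Nat.succ_mul, Finset.prod_range_add, mul_pow, ih]
    have : ∏ j ∈ Finset.range m, B ^ ((N * m + j) / m) = ∏ _j ∈ Finset.range m, B ^ N := by
      refine Finset.prod_congr rfl fun j hj => ?_
      rw [mul_comm, Nat.mul_add_div hm, Nat.div_eq_of_lt (Finset.mem_range.1 hj), add_zero]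
    rw [this, Finset.prod_const, Finset.card_range, ← pow_mul, ← pow_mul, ← pow_add]
    congr 1
    rcases N with _ | N
    · simp
    · simp only [Nat.add_sub_cancel]; ring

lemma log_factorial_le (n : ℕ) : Real.log n.factorial ≤ n * Real.log n := by
  rw [← Real.log_pow]
  refine Real.log_le_log (by exact_mod_cast n.factorial_pos) ?_
  exact_mod_cast n.factorial_le_pow

lemma nthDiam_le_exp {A : Set L} {R B : ℝ} (hR : 1 ≤ R) (hAR : ∀ x ∈ A, v x ≤ R)
    {p : L[X]} (hp : p.Monic) (hm : 1 ≤ p.natDegree) (hB : 0 < B)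
    (hpB : ∀ x ∈ A, v (p.eval x) ≤ B) {N : ℕ} (hN : 2 ≤ N) :
    nthDiam (fun x y => v (x - y)) A (N * p.natDegree) ≤
      Real.exp (Real.log B / p.natDegree
        + 2 * (Real.log (N * p.natDegree : ℕ) / ((N * p.natDegree : ℕ) - 1))
        + (2 * p.natDegree * Real.log R - (p.natDegree - 1) / p.natDegree * Real.log B)
          / ((N * p.natDegree : ℕ) - 1)) := by
  set m := p.natDegree with hmdef
  refine Real.sSup_le ?_ (Real.exp_pos _).le
  rintro _ ⟨x, hx, rfl⟩
  have hle := pairDistProd_le_of_monic_s2 v hR hAR hp hm hB hpB hx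
  rw [← hmdef, Finset.prod_mul_distrib, Finset.prod_const, Finset.card_range, mul_pow, mul_pow,
    prod_range_mul_pow_div_sq B hm] at hle
  have hR0 : 0 < R := by linarith
  have hm1 : (1 : ℝ) ≤ m := by exact_mod_cast hm
  have hN2 : (2 : ℝ) ≤ N := by exact_mod_cast hN
  have hn : (N * m : ℕ) = (N * m : ℝ) := by push_cast; ring
  have hn1 : (1 : ℝ) < N * m := by nlinarith
  have hfac : (0 : ℝ) < ((N * m).factorial : ℝ) := by exact_mod_cast Nat.factorial_pos _
  refine (Real.rpow_le_rpow (pairDistProd_nonneg_s2 (fun _ _ => v.nonneg _) x) hle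
    (inv_nonneg.2 (natCast_mul_pred_nonneg _))).trans ?_
  rw [Real.rpow_def_of_pos (by positivity), Real.exp_le_exp,
    Real.log_mul (by positivity) (by positivity), Real.log_mul (by positivity) (by positivity)]
  simp only [Real.log_pow]
  have hlog := log_factorial_le (N * m)
  have hN1 : ((N - 1 : ℕ) : ℝ) = N - 1 := by
    rw [Nat.cast_sub (by omega)]; simp
  rw [← div_eq_mul_inv, div_le_iff₀ (by rw [hn]; exact mul_pos (by linarith) (by linarith))]
  push_cast [hN1] at hlog ⊢
  have hne : (N : ℝ) * m - 1 ≠ 0 := by linarith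
  have hne' : (m : ℝ) * N - 1 ≠ 0 := by rwa [mul_comm]
  have hm0 : (m : ℝ) ≠ 0 := by linarith
  have e : (Real.log B / m + 2 * (Real.log (N * m) / (N * m - 1))
      + (2 * m * Real.log R - (m - 1) / m * Real.log B) / (N * m - 1)) * (N * m * (N * m - 1))
      = 2 * (N * m * Real.log (N * m)) + m * (N * (N - 1)) * Real.log B
        + 2 * (N * m * (m * Real.log R)) := by
    field_simp
    ring
  rw [e]
  linarith

/-- The transfinite diameter is bounded by the supremum of any monic polynomial on the set. -/
lemma transDiam_pow_le_of_monic {A : Set L} (hA : ∃ M : ℝ, ∀ x ∈ A, v x ≤ M) {B : ℝ}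
    {p : L[X]} (hp : p.Monic) (hm : 1 ≤ p.natDegree) (hB : 0 < B)
    (hpB : ∀ x ∈ A, v (p.eval x) ≤ B) :
    transDiam (fun x y => v (x - y)) A ^ p.natDegree ≤ B := by
  obtain ⟨M, hM⟩ := hA
  have hd : ∀ x y : L, 0 ≤ v (x - y) := fun _ _ => v.nonneg _
  have hbound := fun N (hN : 2 ≤ N) =>
    (transDiam_le_nthDiam hd A (hN.trans (Nat.le_mul_of_pos_right N hm))).trans
      (nthDiam_le_exp v (le_max_left 1 M) (fun x hx => le_max_of_le_right (hM x hx))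
        hp hm hB hpB hN)
  set m := p.natDegree
  have htop : Tendsto (fun N : ℕ => ((N * m : ℕ) : ℝ)) atTop atTop :=
    tendsto_natCast_atTop_atTop.comp
      (tendsto_atTop_mono (fun N => Nat.le_mul_of_pos_right N hm) tendsto_id)
  have h1 : Tendsto (fun N : ℕ => Real.log (N * m : ℕ) / ((N * m : ℕ) - 1)) atTop (𝓝 0) := by
    refine ((Real.tendsto_pow_log_div_mul_add_atTop 1 (-1) 1 one_ne_zero).comp htop).congr ?_
    intro N
    simp [sub_eq_add_neg]
  have h2 : ∀ K : ℝ, Tendsto (fun N : ℕ => K / (((N * m : ℕ) : ℝ) - 1)) atTop (𝓝 0) := fun K =>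
    (tendsto_atTop_add_const_right _ (-1) htop).const_div_atTop K
  have hlim := (Real.continuous_exp.tendsto _).comp
    (((h1.const_mul 2).const_add (Real.log B / m)).add
      (h2 (2 * m * Real.log (max 1 M) - (m - 1) / m * Real.log B)))
  have hle := ge_of_tendsto hlim ((eventually_ge_atTop 2).mono hbound)
  have hm0 : (m : ℝ) ≠ 0 := by positivity
  calc transDiam (fun x y => v (x - y)) A ^ m ≤ Real.exp (Real.log B / m) ^ m :=
        pow_le_pow_left₀ (transDiam_nonneg hd A) (by simpa using hle) m
    _ = B := by rw [← Real.exp_nat_mul, mul_div_cancel₀ _ hm0, Real.exp_log hB]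

lemma exists_bound_preimage {A : Set L} (hA : ∃ M : ℝ, ∀ x ∈ A, v x ≤ M) {φ : L[X]}
    (hd : 1 ≤ φ.natDegree) : ∃ M : ℝ, ∀ z ∈ {z : L | φ.eval z ∈ A}, v z ≤ M := by
  obtain ⟨M, hM⟩ := hA
  have h : Tendsto (fun z => v (φ.eval z)) (comap v atTop) atTop :=
    φ.tendsto_abv_atTop v (natDegree_pos_iff_degree_pos.1 hd) tendsto_comap
  obtain ⟨s, hs, hsub⟩ := mem_comap.1 (h.eventually_gt_atTop M)
  obtain ⟨K, hK⟩ := mem_atTop_sets.1 hs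
  refine ⟨K, fun z hz => ?_⟩
  by_contra! hlt
  exact (hM _ hz).not_gt (hsub (hK _ hlt.le))

lemma transDiam_preimage_pow_le {A : Set L} (hA : ∃ M : ℝ, ∀ x ∈ A, v x ≤ M) {φ : L[X]}
    (hd : 1 ≤ φ.natDegree) :
    transDiam (fun x y => v (x - y)) {z : L | φ.eval z ∈ A} ^ φ.natDegree ≤
      transDiam (fun x y => v (x - y)) A / v φ.leadingCoeff := by
  have hnn : ∀ x y : L, 0 ≤ v (x - y) := fun _ _ => v.nonneg _
  have ha0 : φ.leadingCoeff ≠ 0 := leadingCoeff_ne_zero.2 (by rintro rfl; simp at hd)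
  have ha : 0 < v φ.leadingCoeff := v.pos ha0
  rw [le_div_iff₀ ha]
  refine le_of_forall_gt_imp_ge_of_dense fun t ht => ?_
  have ht0 : 0 < t := (transDiam_nonneg hnn A).trans_lt ht
  rw [← le_div_iff₀ ha]
  obtain ⟨p, hp, hm, hpt⟩ := exists_monic_of_transDiam_lt v hA ht
  set q : L[X] := C (φ.leadingCoeff ^ p.natDegree)⁻¹ * p.comp φ
  have hq : q.Monic := by
    rw [Monic, leadingCoeff_mul, leadingCoeff_C, leadingCoeff_comp (by omega), hp.leadingCoeff,
      one_mul, inv_mul_cancel₀ (pow_ne_zero _ ha0)]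
  have hqd : q.natDegree = φ.natDegree * p.natDegree := by
    rw [natDegree_C_mul (inv_ne_zero (pow_ne_zero _ ha0)), natDegree_comp, mul_comm]
  have h := transDiam_pow_le_of_monic v (exists_bound_preimage v hA hd) hq
    (by rw [hqd]; exact Nat.mul_pos hd hm) (B := (t / v φ.leadingCoeff) ^ p.natDegree)
    (by positivity) (fun z hz => by
      rw [eval_mul, eval_C, eval_comp, map_mul, map_inv₀, map_pow, div_pow, div_eq_inv_mul]
      exact mul_le_mul_of_nonneg_left (hpt _ hz) (by positivity))
  rw [hqd, pow_mul] at h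
  exact (pow_le_pow_iff_left₀ (pow_nonneg (transDiam_nonneg hnn _) _) (by positivity)
    (by omega)).1 h

lemma eval_eq_prod_roots_sub [IsAlgClosed L] (p : L[X]) (z : L) :
    p.eval z = p.leadingCoeff * (p.roots.map fun r => z - r).prod := by
  conv_lhs => rw [(IsAlgClosed.splits p).eq_prod_roots]
  simp [eval_multiset_prod, Multiset.map_map]

/-- The norm of `q` along `φ`, as a monic polynomial of the same degree as `q`. -/
lemma exists_monic_norm [IsAlgClosed L] {φ : L[X]} (hd : 1 ≤ φ.natDegree) {q : L[X]}
    (hq : q.Monic) {A : Set L} {B : ℝ} (hB : ∀ z ∈ {z : L | φ.eval z ∈ A}, v (q.eval z) ≤ B) :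
    ∃ p : L[X], p.Monic ∧ p.natDegree = q.natDegree ∧
      ∀ w ∈ A, v (p.eval w) ≤ v φ.leadingCoeff ^ q.natDegree * B ^ φ.natDegree := by
  have hcard : q.roots.card = q.natDegree := IsAlgClosed.card_roots_eq_natDegree
  refine ⟨((q.roots.map fun r => φ.eval r).map fun s => X - C s).prod,
    monic_multiset_prod_of_monic _ _ fun _ _ => monic_X_sub_C _, ?_, fun w hw => ?_⟩
  · rw [natDegree_multiset_prod_X_sub_C_eq_card, Multiset.card_map, hcard]
  set ψ := φ - C w
  have hlead : ψ.leadingCoeff = φ.leadingCoeff := leadingCoeff_sub_of_degree_lt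
    (degree_C_le.trans_lt (natDegree_pos_iff_degree_pos.1 hd))
  have hdeg : ψ.roots.card = φ.natDegree := by
    rw [IsAlgClosed.card_roots_eq_natDegree, natDegree_sub_C]
  have hroot : ∀ s ∈ ψ.roots, φ.eval s = w := fun s hs => by
    have := isRoot_of_mem_roots hs
    simpa [ψ, sub_eq_zero] using this
  have h1 : v (eval w ((q.roots.map fun r => φ.eval r).map fun s => X - C s).prod) =
      (q.roots.map fun r => v φ.leadingCoeff * (ψ.roots.map fun s => v (s - r)).prod).prod := by
    rw [eval_multiset_prod, map_multiset_prod, Multiset.map_map, Multiset.map_map,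
      Multiset.map_map]
    congr 1
    refine Multiset.map_congr rfl fun r _ => ?_
    have := eval_eq_prod_roots_sub ψ r
    simp only [Function.comp_apply, eval_sub, eval_X, eval_C]
    rw [v.map_sub, show φ.eval r - w = ψ.eval r by simp [ψ], this, map_mul, hlead,
      map_multiset_prod, Multiset.map_map]
    simp_rw [Function.comp_def, v.map_sub r]
  have h2 : ∀ s, (q.roots.map fun r => v (s - r)).prod = v (q.eval s) := fun s => by
    rw [eval_eq_prod_roots_sub q s, hq.leadingCoeff, one_mul, map_multiset_prod, Multiset.map_map]
    rfl
  rw [h1, Multiset.prod_map_mul, Multiset.map_const', Multiset.prod_replicate, hcard,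
    Multiset.prod_map_prod_map]
  simp_rw [h2]
  refine mul_le_mul_of_nonneg_left ?_ (pow_nonneg (v.nonneg _) _)
  calc (ψ.roots.map fun s => v (q.eval s)).prod ≤ (ψ.roots.map fun _ => B).prod :=
        Multiset.prod_map_le_prod_map₀ _ _ (fun _ _ => v.nonneg _) fun s hs =>
          hB s (by simpa [hroot s hs] using hw)
    _ = B ^ φ.natDegree := by rw [Multiset.map_const', Multiset.prod_replicate, hdeg]

lemma transDiam_le_preimage_pow [IsAlgClosed L] {A : Set L} (hA : ∃ M : ℝ, ∀ x ∈ A, v x ≤ M)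
    {φ : L[X]} (hd : 1 ≤ φ.natDegree) :
    transDiam (fun x y => v (x - y)) A ≤ v φ.leadingCoeff *
      transDiam (fun x y => v (x - y)) {z : L | φ.eval z ∈ A} ^ φ.natDegree := by
  have hnn : ∀ x y : L, 0 ≤ v (x - y) := fun _ _ => v.nonneg _
  have ha : 0 < v φ.leadingCoeff := v.pos (leadingCoeff_ne_zero.2 (by rintro rfl; simp at hd))
  set c := transDiam (fun x y => v (x - y)) {z : L | φ.eval z ∈ A}
  have hcont : Tendsto (fun t : ℝ => v φ.leadingCoeff * t ^ φ.natDegree) (𝓝[>] c)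
      (𝓝 (v φ.leadingCoeff * c ^ φ.natDegree)) :=
    ((continuous_const.mul (continuous_pow _)).tendsto c).mono_left nhdsWithin_le_nhds
  refine ge_of_tendsto hcont (eventually_mem_nhdsWithin.mono fun t (ht : c < t) => ?_)
  have ht0 : 0 < t := (transDiam_nonneg hnn _).trans_lt ht
  obtain ⟨q, hq, hm, hqt⟩ := exists_monic_of_transDiam_lt v (exists_bound_preimage v hA hd) ht
  obtain ⟨p, hp, hpd, hpB⟩ := exists_monic_norm v hd hq hqt
  have h := transDiam_pow_le_of_monic v hA hp (hpd ▸ hm) (by positivity) hpB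
  rw [hpd, ← pow_mul, mul_comm q.natDegree, pow_mul, ← mul_pow] at h
  exact (pow_le_pow_iff_left₀ (transDiam_nonneg hnn _) (by positivity) (by omega)).1 h

end AbsoluteValue

/-- Let `L` be an algebraically closed field with an absolute value `v`,
let `A ⊆ L` be bounded, and let `φ ∈ L[z]` have degree `d ≥ 1` with leading coefficient
`a_d`.  If `A* = φ⁻¹(A)`, then `c(A*) = (c(A)/v(a_d))^(1/d)`. -/
theorem stmt2 {L : Type*} [Field L] [IsAlgClosed L] (v : AbsoluteValue L ℝ)
    (A : Set L) (hA : ∃ M : ℝ, ∀ x ∈ A, v x ≤ M)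
    (φ : Polynomial L) (hd : 1 ≤ φ.natDegree) :
    transDiam (fun x y => v (x - y)) {z : L | Polynomial.eval z φ ∈ A} =
      (transDiam (fun x y => v (x - y)) A / v φ.leadingCoeff) ^
        ((φ.natDegree : ℝ)⁻¹) := by
  have hnn : ∀ x y : L, 0 ≤ v (x - y) := fun _ _ => v.nonneg _
  have ha : 0 < v φ.leadingCoeff :=
    v.pos (Polynomial.leadingCoeff_ne_zero.2 (by rintro rfl; simp at hd))
  have h := le_antisymm (transDiam_preimage_pow_le v hA hd)
    ((div_le_iff₀' ha).2 (transDiam_le_preimage_pow v hA hd))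
  rw [← h, Real.pow_rpow_inv_natCast (transDiam_nonneg hnn _) (by omega)]
end
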